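/- arXiv:1503.03415 — 6 statements merged into one kernel-verified Lean document; each statement's English description precedes it below -/
import Mathlib

section
/- Let A be a real 2×2 matrix with zero trace (A₁₁ + A₂₂ = 0). Then for every vector v ∈ ℝ², |⟨A v, v⟩| ≤ 2^{-1/2} ‖A‖_F ‖v‖², where ‖A‖_F = (Σ_{i,j} A_{ij}²)^{1/2} is the Frobenius (Hilbert–Schmidt) norm of A. -/
open Matrix

/-- For any trace-free real 2×2 matrix `A` and every `v ∈ ℝ²`,
`|⟨A v, v⟩| ≤ 2^{-1/2} ‖A‖_F ‖v‖²`, where `‖A‖_F` is the Frobenius norm. -/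
theorem abs_quadratic_form_le_frobenius_of_traceless
    (A : Matrix (Fin 2) (Fin 2) ℝ) (hA : A 0 0 + A 1 1 = 0) (v : Fin 2 → ℝ) :
    |A.mulVec v ⬝ᵥ v| ≤
      (2 : ℝ) ^ (-(1 : ℝ) / 2) * Real.sqrt (∑ i, ∑ j, A i j ^ 2) *
        (v 0 ^ 2 + v 1 ^ 2) := by
  have hd : A 1 1 = -A 0 0 := by linarith
  have h2 : ((2 : ℝ) ^ (-(1 : ℝ) / 2)) ^ 2 = 1 / 2 := by
    rw [← Real.rpow_natCast, ← Real.rpow_mul (by norm_num)]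
    norm_num [Real.rpow_neg_one]
  have hS : 0 ≤ ∑ i, ∑ j, A i j ^ 2 := by positivity
  refine abs_le_of_sq_le_sq ?_ (by positivity)
  rw [mul_pow, mul_pow, h2, Real.sq_sqrt hS]
  simp only [Matrix.mulVec, dotProduct, Fin.sum_univ_two, hd]
  nlinarith [sq_nonneg (2 * A 0 0 * v 0 * v 1 - (A 0 1 + A 1 0) / 2 * (v 0 ^ 2 - v 1 ^ 2)),
    sq_nonneg ((A 0 1 - A 1 0) / 2 * (v 0 ^ 2 + v 1 ^ 2))]
end

section
/- (Ladyzhenskaya inequality.) There exists a constant C > 0 such that for every smooth compactly supported vector field u : ℝ² → ℝ², one has ‖u‖_{L⁴(ℝ²)}² ≤ C ‖u‖_{L²(ℝ²)} ‖∇u‖_{L²(ℝ²)}, where ‖u‖_{L⁴}⁴ = ∫_{ℝ²} ‖u(x)‖⁴ dx, ‖u‖_{L²}² = ∫_{ℝ²} ‖u(x)‖² dx, and ‖∇u‖_{L²}² = ∫_{ℝ²} Σ_{i,j=1}^{2} (∂_{x_i} u^j(x))² dx. -/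
open MeasureTheory

noncomputable abbrev euclBasis (i : Fin 2) : EuclideanSpace ℝ (Fin 2) :=
  EuclideanSpace.single i 1

lemma lady_opNorm_le (L : EuclideanSpace ℝ (Fin 2) →L[ℝ] EuclideanSpace ℝ (Fin 2)) :
    ‖L‖ ≤ Real.sqrt (∑ i, ∑ j, (L (euclBasis i) j) ^ 2) := by
  refine L.opNorm_le_bound (Real.sqrt_nonneg _) fun h => ?_
  have hh : h = h 0 • euclBasis 0 + h 1 • euclBasis 1 := by
    ext i; fin_cases i <;> simp [euclBasis]
  have hL : L h = h 0 • L (euclBasis 0) + h 1 • L (euclBasis 1) := by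
    conv_lhs => rw [hh]
    simp only [map_add, map_smul]
  have e0 : L h 0 = h 0 * L (euclBasis 0) 0 + h 1 * L (euclBasis 1) 0 := by
    rw [hL]; simp
  have e1 : L h 1 = h 0 * L (euclBasis 0) 1 + h 1 * L (euclBasis 1) 1 := by
    rw [hL]; simp
  rw [EuclideanSpace.norm_eq (L h), EuclideanSpace.norm_eq h, ← Real.sqrt_mul (by positivity)]
  apply Real.sqrt_le_sqrt
  simp only [Fin.sum_univ_two, Real.norm_eq_abs, sq_abs, e0, e1]
  nlinarith [sq_nonneg (h 0 * L (euclBasis 1) 0 - h 1 * L (euclBasis 0) 0),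
    sq_nonneg (h 0 * L (euclBasis 1) 1 - h 1 * L (euclBasis 0) 1)]

/-- Ladyzhenskaya inequality: there is a universal constant `C > 0` such that
`‖u‖_{L⁴}² ≤ C ‖u‖_{L²} ‖∇u‖_{L²}` for all smooth compactly supported vector fields
`u : ℝ² → ℝ²`. -/
theorem ladyzhenskaya_inequality :
    ∃ C > (0 : ℝ), ∀ u : EuclideanSpace ℝ (Fin 2) → EuclideanSpace ℝ (Fin 2),
      ContDiff ℝ (⊤ : ℕ∞) u → HasCompactSupport u →
      Real.sqrt (∫ x, ‖u x‖ ^ 4) ≤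
        C * Real.sqrt (∫ x, ‖u x‖ ^ 2) *
          Real.sqrt (∫ x, ∑ i, ∑ j, (fderiv ℝ u x (euclBasis i) j) ^ 2) := by
  set K : ℝ := ((lintegralPowLePowLIntegralFDerivConst
    (volume : Measure (EuclideanSpace ℝ (Fin 2))) 2 : NNReal) : ℝ) with hK
  have hK0 : 0 ≤ K := NNReal.coe_nonneg _
  refine ⟨2 * Real.sqrt K + 1, by positivity, fun u hu hc => ?_⟩
  have hu1 : ContDiff ℝ 1 u := hu.of_le (by exact_mod_cast le_top)
  have hucont : Continuous u := hu1.continuous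
  have hdc : Continuous (fderiv ℝ u) := hu1.continuous_fderiv one_ne_zero
  have hds : HasCompactSupport (fderiv ℝ u) := hc.fderiv ℝ
  set S : EuclideanSpace ℝ (Fin 2) → ℝ :=
    fun x => ∑ i, ∑ j, (fderiv ℝ u x (euclBasis i) j) ^ 2 with hS
  have hS0 : ∀ x, 0 ≤ S x := fun x => by simp only [hS]; positivity
  have hScont : Continuous S := by
    simp only [hS]
    fun_prop
  have hSs : HasCompactSupport S := by
    refine hds.comp_left (g := fun L : EuclideanSpace ℝ (Fin 2) →L[ℝ] EuclideanSpace ℝ (Fin 2) =>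
      ∑ i, ∑ j, (L (euclBasis i) j) ^ 2) ?_
    simp
  -- the scalar function
  set v : EuclideanSpace ℝ (Fin 2) → ℝ := fun x => ‖u x‖ ^ 2 with hv
  have hv1 : ContDiff ℝ 1 v := hu1.norm_sq ℝ
  have hvs : HasCompactSupport v := hc.comp_left (g := fun y => ‖y‖ ^ 2) (by simp)
  have hvd : ∀ x, ‖fderiv ℝ v x‖ ≤ 2 * (‖u x‖ * Real.sqrt (S x)) := by
    intro x
    have hd := ((hu1.differentiable one_ne_zero x).hasFDerivAt.norm_sq).fderiv
    have h1 : ‖fderiv ℝ v x‖ ≤ 2 * (‖u x‖ * ‖fderiv ℝ u x‖) := by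
      simp only [hv]
      rw [hd]
      refine ContinuousLinearMap.opNorm_le_bound _ (by positivity) fun h => ?_
      simp only [ContinuousLinearMap.smul_apply, ContinuousLinearMap.comp_apply,
        innerSL_apply_apply, nsmul_eq_mul, norm_mul]
      have a := norm_inner_le_norm (𝕜 := ℝ) (u x) (fderiv ℝ u x h)
      have b := (fderiv ℝ u x).le_opNorm h
      have c := mul_le_mul_of_nonneg_left b (norm_nonneg (u x))
      norm_num
      norm_num at a
      linarith
    exact h1.trans (by gcongr; exact lady_opNorm_le _)
  have hfin : Real.HolderConjugate
      (Module.finrank ℝ (EuclideanSpace ℝ (Fin 2)) : ℝ) 2 := by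
    simp only [finrank_euclideanSpace, Fintype.card_fin]
    exact_mod_cast Real.HolderConjugate.two_two
  have key := lintegral_pow_le_pow_lintegral_fderiv
    (volume : Measure (EuclideanSpace ℝ (Fin 2))) hv1 hvs hfin
  have hdvc : Continuous (fderiv ℝ v) := hv1.continuous_fderiv one_ne_zero
  have hi1 : Integrable (fderiv ℝ v) := hdvc.integrable_of_hasCompactSupport (hvs.fderiv ℝ)
  have hL : ∫⁻ x, ‖v x‖ₑ ^ (2:ℝ) = ENNReal.ofReal (∫ x, ‖u x‖ ^ 4) := by
    rw [ofReal_integral_eq_lintegral_ofReal]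
    · congr! 2 with x
      rw [← ofReal_norm, ENNReal.ofReal_rpow_of_nonneg (norm_nonneg _) (by norm_num)]
      congr 1
      simp only [hv, norm_pow, norm_norm]
      norm_cast
      ring
    · refine Continuous.integrable_of_hasCompactSupport (by fun_prop) ?_
      exact hc.comp_left (g := fun y => ‖y‖ ^ 4) (by simp)
    · exact Filter.Eventually.of_forall fun x => by positivity
  have hR : ∫⁻ x, ‖fderiv ℝ v x‖ₑ = ENNReal.ofReal (∫ x, ‖fderiv ℝ v x‖) :=
    (ofReal_integral_norm_eq_lintegral_enorm hi1).symm
  have hI0 : 0 ≤ ∫ x, ‖fderiv ℝ v x‖ := integral_nonneg fun x => norm_nonneg _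
  have key2 : ∫ x, ‖u x‖ ^ 4 ≤ K * (∫ x, ‖fderiv ℝ v x‖) ^ 2 := by
    rw [hL, hR, ENNReal.ofReal_rpow_of_nonneg hI0 (by norm_num), ← ENNReal.ofReal_coe_nnreal,
      ← ENNReal.ofReal_mul (NNReal.coe_nonneg _), ENNReal.ofReal_le_ofReal_iff (by positivity)] at key
    exact_mod_cast key
  have hsq : Continuous fun x => Real.sqrt (S x) := hScont.sqrt
  have hsqs : HasCompactSupport fun x => Real.sqrt (S x) :=
    hSs.comp_left (g := Real.sqrt) (by simp)
  have hCS : ∫ x, ‖u x‖ * Real.sqrt (S x) ≤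
      Real.sqrt (∫ x, ‖u x‖ ^ 2) * Real.sqrt (∫ x, S x) := by
    have h := integral_mul_le_Lp_mul_Lq_of_nonneg
      (μ := (volume : Measure (EuclideanSpace ℝ (Fin 2)))) Real.HolderConjugate.two_two
      (f := fun x => ‖u x‖) (g := fun x => Real.sqrt (S x))
      (Filter.Eventually.of_forall fun x => norm_nonneg _)
      (Filter.Eventually.of_forall fun x => Real.sqrt_nonneg _)
      (hucont.norm.memLp_of_hasCompactSupport hc.norm)
      (hsq.memLp_of_hasCompactSupport hsqs)
    simp only [Real.rpow_two, Real.sq_sqrt (hS0 _), ← Real.sqrt_eq_rpow] at h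
    exact h
  have hmono : ∫ x, ‖fderiv ℝ v x‖ ≤ 2 * ∫ x, ‖u x‖ * Real.sqrt (S x) := by
    rw [← integral_const_mul]
    refine integral_mono hi1.norm ?_ hvd
    refine Continuous.integrable_of_hasCompactSupport (by fun_prop) ?_
    exact (hsqs.mul_left (f := fun x => ‖u x‖)).mul_left (f := fun _ => (2:ℝ))
  calc Real.sqrt (∫ x, ‖u x‖ ^ 4) ≤ Real.sqrt (K * (∫ x, ‖fderiv ℝ v x‖) ^ 2) :=
        Real.sqrt_le_sqrt key2
    _ = Real.sqrt K * ∫ x, ‖fderiv ℝ v x‖ := by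
        rw [Real.sqrt_mul hK0, Real.sqrt_sq hI0]
    _ ≤ Real.sqrt K * (2 * (Real.sqrt (∫ x, ‖u x‖ ^ 2) * Real.sqrt (∫ x, S x))) := by
        gcongr; linarith
    _ ≤ (2 * Real.sqrt K + 1) * Real.sqrt (∫ x, ‖u x‖ ^ 2) * Real.sqrt (∫ x, S x) := by
        have : 0 ≤ Real.sqrt (∫ x, ‖u x‖ ^ 2) * Real.sqrt (∫ x, S x) := by positivity
        linarith
end

section
/- (Lieb–Thirring inequality for divergence-free orthonormal families.) Let v₁, …, v_m : ℝ² → ℝ² be smooth compactly supported vector fields that are orthonormal in L²(ℝ²; ℝ²) (i.e. ∫_{ℝ²} ⟨v_j(x), v_k(x)⟩ dx = δ_{jk}) and divergence free (∂_{x₁} v_j¹ + ∂_{x₂} v_j² = 0 for each j). Set ρ(x) = Σ_{j=1}^{m} ‖v_j(x)‖². Then ∫_{ℝ²} ρ(x)² dx ≤ (1/(2√3)) Σ_{j=1}^{m} ∫_{ℝ²} Σ_{i,k=1}^{2} (∂_{x_i} v_j^k(x))² dx. -/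
open MeasureTheory RealInnerProductSpace

namespace LTaux
open Function SchwartzMap FourierTransform Real
set_option linter.unusedSectionVars false
open scoped ContDiff ENNReal

abbrev V2 := EuclideanSpace ℝ (Fin 2)

variable {F : Type*} [NormedAddCommGroup F] [InnerProductSpace ℂ F] [CompleteSpace F]

lemma temperate_exp {a : ℝ} (ha : 0 ≤ a) :
    (fun ξ : V2 => Real.exp (-(a * ‖ξ‖ ^ 2))).HasTemperateGrowth := by
  have h := HasTemperateGrowth.comp' (g := fun y : ℝ => Real.exp ((-1) * y))
    (f := fun ξ : V2 => a * ‖ξ‖ ^ 2) (t := Set.Ioi (-1)) ?_ isOpen_Ioi.uniqueDiffOn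
    (by fun_prop) ?_ ?_
  · simpa [comp_def] using h
  · rintro _ ⟨y, rfl⟩
    have : 0 ≤ a * ‖y‖ ^ 2 := by positivity
    simp only [Set.mem_Ioi]; linarith
  · intro N
    refine ⟨0, Real.exp 1, (Real.exp_pos _).le, fun n _ x hx => ?_⟩
    rw [iteratedFDerivWithin_of_isOpen n isOpen_Ioi hx, norm_iteratedFDeriv_eq_norm_iteratedDeriv,
      iteratedDeriv_exp_const_mul]
    simp only [Set.mem_Ioi] at hx
    simp
    linarith
  · exact (HasTemperateGrowth.const a).mul (hasTemperateGrowth_norm_sq _)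

/-- the multiplier -/
noncomputable def mul (τ : ℝ) (ξ : V2) : ℝ :=
  (4 * π ^ 2 * ‖ξ‖ ^ 2) * Real.exp (-(τ * (4 * π ^ 2) * ‖ξ‖ ^ 2))

lemma temperate_mul {τ : ℝ} (hτ : 0 ≤ τ) : (mul τ).HasTemperateGrowth := by
  refine HasTemperateGrowth.mul ((HasTemperateGrowth.const (4 * π ^ 2)).mul
    (hasTemperateGrowth_norm_sq _)) (temperate_exp (by positivity))

noncomputable def A (g : 𝓢(V2, F)) (τ : ℝ) (x : V2) : F := 𝓕⁻ (fun ξ => mul τ ξ • g ξ) x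

lemma A_eq (g : 𝓢(V2, F)) {τ : ℝ} (hτ : 0 ≤ τ) :
    A g τ = 𝓕⁻ (smulLeftCLM F (mul τ) g) := by
  rw [fourierInv_coe, smulLeftCLM_apply (temperate_mul hτ)]
  rfl

lemma lint_eq (f : 𝓢(V2, F)) : ∫⁻ x, ‖f x‖ₑ ^ 2 = ENNReal.ofReal (∫ x, ‖f x‖ ^ 2) := by
  rw [ofReal_integral_eq_lintegral_ofReal]
  · congr with x
    rw [ENNReal.ofReal_pow (norm_nonneg _), ofReal_norm]
  · exact (memLp_two_iff_integrable_sq_norm f.continuous.aestronglyMeasurable).1 (f.memLp 2)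
  · exact Filter.Eventually.of_forall fun x => by positivity

lemma B1 (g : 𝓢(V2, F)) {τ : ℝ} (hτ : 0 ≤ τ) :
    ∫⁻ x, ‖A g τ x‖ₑ ^ 2 = ∫⁻ ξ, ‖mul τ ξ • g ξ‖ₑ ^ 2 := by
  have h1 : ∀ ξ, mul τ ξ • g ξ = smulLeftCLM F (mul τ) g ξ := fun ξ => by
    rw [smulLeftCLM_apply (temperate_mul hτ)]
  simp_rw [A_eq g hτ, h1]
  rw [lint_eq, lint_eq, ← integral_norm_sq_fourier (𝓕⁻ _)]
  simp

lemma A_cont (g : 𝓢(V2, F)) :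
    Continuous fun p : (ℝ × V2) × V2 => 𝐞 (inner ℝ p.2 p.1.2) • (mul p.1.1 p.2 • g p.2) := by
  have := g.continuous
  unfold mul
  have h2 : Continuous fun p : (ℝ × V2) × V2 => 𝐞 (inner ℝ p.2 p.1.2) :=
    continuous_fourierChar.comp (by fun_prop)
  refine h2.smul ?_
  fun_prop

lemma B3 (g : 𝓢(V2, F)) : StronglyMeasurable fun p : ℝ × V2 => A g p.1 p.2 := by
  have := (A_cont g)
  simp only [A, Real.fourierInv_eq]
  exact StronglyMeasurable.integral_prod_right (f := fun (p : ℝ × V2) (ξ : V2) =>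
    𝐞 (inner ℝ ξ p.2) • (mul p.1 ξ • g ξ)) (this.stronglyMeasurable)

lemma int_exp {b : ℝ} (hb : 0 < b) : ∫⁻ τ in Set.Ioi (0:ℝ), ENNReal.ofReal (Real.exp (-(b * τ))) =
    ENNReal.ofReal (1 / b) := by
  rw [← ofReal_integral_eq_lintegral_ofReal]
  · congr 1
    have := integral_exp_mul_Ioi (a := -b) (by linarith) 0
    simp only [neg_mul] at this
    rw [this]; simp
  · have := integrableOn_exp_mul_Ioi (a := -b) (by linarith) 0
    simp only [neg_mul] at this
    exact this
  · exact Filter.Eventually.of_forall fun x => (Real.exp_pos _).le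

lemma B2 (g : 𝓢(V2, F)) :
    ∫⁻ x, ∫⁻ τ in Set.Ioi (0:ℝ), ‖A g τ x‖ₑ ^ 2 =
      ∫⁻ ξ, ENNReal.ofReal (2 * π ^ 2 * ‖ξ‖ ^ 2 * ‖g ξ‖ ^ 2) := by
  rw [lintegral_lintegral_swap]
  swap
  · exact (((B3 g).comp_measurable measurable_swap).enorm.pow_const 2).aemeasurable
  rw [setLIntegral_congr_fun measurableSet_Ioi (fun τ hτ => B1 g (le_of_lt hτ))]
  rw [lintegral_lintegral_swap]
  swap
  · refine Measurable.aemeasurable ?_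
    have := g.continuous
    have : Continuous (uncurry fun (τ : ℝ) (ξ : V2) => ‖mul τ ξ • g ξ‖ₑ ^ 2) := by
      unfold mul uncurry
      have : Continuous fun a : ℝ × V2 => (4 * π ^ 2 * ‖a.2‖ ^ 2 * rexp (-(a.1 * (4 * π ^ 2) * ‖a.2‖ ^ 2))) • g a.2 := by fun_prop
      have := this.enorm
      fun_prop
    exact this.measurable
  congr with ξ
  by_cases hξ : ξ = 0
  · simp [hξ, mul]
  have hn : 0 < ‖ξ‖ := norm_pos_iff.2 hξ
  have : ∀ τ, ‖mul τ ξ • g ξ‖ₑ ^ 2 = ENNReal.ofReal ((4 * π ^ 2 * ‖ξ‖ ^ 2) ^ 2 * ‖g ξ‖ ^ 2) *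
      ENNReal.ofReal (Real.exp (-((8 * π ^ 2 * ‖ξ‖ ^ 2) * τ))) := by
    intro τ
    rw [← ENNReal.ofReal_mul (by positivity), ← ofReal_norm,
      ← ENNReal.ofReal_pow (norm_nonneg _), norm_smul, mul]
    congr 1
    rw [Real.norm_of_nonneg (by positivity), mul_pow, mul_pow, ← Real.exp_nat_mul]
    have : (2:ℕ) * -(τ * (4 * π ^ 2) * ‖ξ‖ ^ 2) = -((8 * π ^ 2 * ‖ξ‖ ^ 2) * τ) := by
      push_cast; ring
    rw [this]; ring
  simp_rw [this]
  rw [lintegral_const_mul _ (by fun_prop), int_exp (by positivity),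
    ← ENNReal.ofReal_mul (by positivity)]
  congr 1
  field_simp
  ring

noncomputable def hh (E : ℝ) (ξ : V2) : ℝ :=
  1 / 2 * (Real.exp (-(E * (4 * π ^ 2) * ‖ξ‖ ^ 2)) + Real.exp (-(3 * E * (4 * π ^ 2) * ‖ξ‖ ^ 2)))

noncomputable def psi (E τ : ℝ) : ℝ := if τ ≤ E then 1 else 1 / 2

lemma psi_meas (E : ℝ) : Measurable (psi E) := by
  unfold psi
  exact Measurable.ite measurableSet_Iic measurable_const measurable_const

lemma psi_norm (E τ : ℝ) : ‖psi E τ‖ ≤ 1 := by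
  unfold psi
  split_ifs <;> norm_num

lemma Ioc_split {E : ℝ} (hE : 0 < E) : Set.Ioc 0 (3 * E) = Set.Ioc 0 E ∪ Set.Ioc E (3 * E) :=
  (Set.Ioc_union_Ioc_eq_Ioc hE.le (by linarith)).symm

lemma Ioc_disj {E : ℝ} : Disjoint (Set.Ioc 0 E) (Set.Ioc E (3 * E)) :=
  Set.Ioc_disjoint_Ioc_of_le le_rfl

lemma int_mul {a b : ℝ} (hab : a ≤ b) (ξ : V2) : ∫ τ in Set.Ioc a b, mul τ ξ =
    Real.exp (-(a * (4 * π ^ 2) * ‖ξ‖ ^ 2)) - Real.exp (-(b * (4 * π ^ 2) * ‖ξ‖ ^ 2)) := by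
  rw [← intervalIntegral.integral_of_le hab]
  rw [intervalIntegral.integral_eq_sub_of_hasDerivAt
    (f := fun τ => -Real.exp (-(τ * (4 * π ^ 2) * ‖ξ‖ ^ 2)))]
  · ring
  · intro τ _
    have h := ((((hasDerivAt_id τ).mul_const (4 * π ^ 2)).mul_const (‖ξ‖ ^ 2)).neg.exp).neg
    have h' : HasDerivAt (fun τ => -Real.exp (-(τ * (4 * π ^ 2) * ‖ξ‖ ^ 2)))
      (-(Real.exp (-(τ * (4 * π ^ 2) * ‖ξ‖ ^ 2)) * -(1 * (4 * π ^ 2) * ‖ξ‖ ^ 2))) τ := h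
    have e : mul τ ξ =
      -(Real.exp (-(τ * (4 * π ^ 2) * ‖ξ‖ ^ 2)) * -(1 * (4 * π ^ 2) * ‖ξ‖ ^ 2)) := by
      rw [mul]; ring
    rw [e]; exact h'
  · apply Continuous.intervalIntegrable
    unfold mul; fun_prop

lemma int_psi_mul {E : ℝ} (hE : 0 < E) (ξ : V2) :
    ∫ τ in Set.Ioc 0 (3 * E), psi E τ * mul τ ξ = 1 - hh E ξ := by
  have hc : Continuous fun τ => mul τ ξ := by unfold mul; fun_prop
  have e1 : ∀ τ ∈ Set.Ioc 0 E, psi E τ * mul τ ξ = mul τ ξ := fun τ hτ => by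
    simp [psi, hτ.2]
  have e2 : ∀ τ ∈ Set.Ioc E (3 * E), psi E τ * mul τ ξ = 1 / 2 * mul τ ξ := fun τ hτ => by
    simp [psi, hτ.1]
  rw [Ioc_split hE, setIntegral_union Ioc_disj measurableSet_Ioc,
    setIntegral_congr_fun measurableSet_Ioc e1, setIntegral_congr_fun measurableSet_Ioc e2,
    integral_const_mul, int_mul hE.le, int_mul (by linarith), hh]
  · simp; ring
  · exact (hc.integrableOn_Ioc).congr_fun (fun τ hτ => (e1 τ hτ).symm) measurableSet_Ioc
  · exact ((continuous_const.mul hc).integrableOn_Ioc).congr_fun (fun τ hτ => (e2 τ hτ).symm)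
      measurableSet_Ioc

lemma lint_psi {E : ℝ} (hE : 0 < E) :
    ∫⁻ τ in Set.Ioc 0 (3 * E), ‖psi E τ‖ₑ ^ 2 = ENNReal.ofReal (3 / 2 * E) := by
  have e1 : ∀ τ ∈ Set.Ioc 0 E, ‖psi E τ‖ₑ ^ 2 = ENNReal.ofReal 1 := fun τ hτ => by
    simp [psi, hτ.2]
  have e2 : ∀ τ ∈ Set.Ioc E (3 * E), ‖psi E τ‖ₑ ^ 2 = ENNReal.ofReal (1 / 4) := fun τ hτ => by
    rw [psi, if_neg (by simpa using hτ.1), ← ofReal_norm, ← ENNReal.ofReal_pow (norm_nonneg _)]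
    norm_num
  rw [Ioc_split hE, lintegral_union measurableSet_Ioc Ioc_disj,
    setLIntegral_congr_fun measurableSet_Ioc e1, setLIntegral_congr_fun measurableSet_Ioc e2]
  simp only [setLIntegral_const, Real.volume_Ioc]
  rw [← ENNReal.ofReal_mul (by norm_num), ← ENNReal.ofReal_mul (by norm_num),
    ← ENNReal.ofReal_add (by nlinarith) (by nlinarith)]
  congr 1; ring

lemma B4_int (g : 𝓢(V2, F)) (E : ℝ) (x : V2) :
    Integrable (uncurry fun (τ : ℝ) (ξ : V2) => psi E τ • (𝐞 (inner ℝ ξ x) • (mul τ ξ • g ξ)))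
      ((volume.restrict (Set.Ioc 0 (3 * E))).prod volume) := by
  have hg : Integrable (fun ξ : V2 => 4 * π ^ 2 * (‖ξ‖ ^ 2 * ‖g ξ‖)) :=
    (g.integrable_pow_mul volume 2).const_mul _
  have hg2 : Integrable (fun p : ℝ × V2 => 4 * π ^ 2 * (‖p.2‖ ^ 2 * ‖g p.2‖))
      ((volume.restrict (Set.Ioc 0 (3 * E))).prod volume) := hg.comp_snd _
  refine hg2.mono' ?_ ?_
  · have hc : Continuous fun p : ℝ × V2 => 𝐞 (inner ℝ p.2 x) • (mul p.1 p.2 • g p.2) :=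
      (A_cont g).comp (f := fun p : ℝ × V2 => ((p.1, x), p.2)) (by fun_prop)
    have hm : StronglyMeasurable fun p : ℝ × V2 => psi E p.1 :=
      ((psi_meas E).comp measurable_fst).stronglyMeasurable
    exact (hm.smul hc.stronglyMeasurable).aestronglyMeasurable
  · have : (volume.restrict (Set.Ioc 0 (3 * E))).prod (volume : Measure V2) =
      (volume.prod volume).restrict (Set.Ioc 0 (3 * E) ×ˢ Set.univ) := by
      rw [← Measure.prod_restrict, Measure.restrict_univ]
    rw [this]
    refine ae_restrict_of_forall_mem (measurableSet_Ioc.prod MeasurableSet.univ) ?_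
    rintro ⟨τ, ξ⟩ ⟨hτ, -⟩
    simp only [uncurry]
    rw [norm_smul, Circle.norm_smul, norm_smul, mul,
      Real.norm_of_nonneg (r := 4 * π ^ 2 * ‖ξ‖ ^ 2 * rexp _) (by positivity)]
    have h1 : Real.exp (-(τ * (4 * π ^ 2) * ‖ξ‖ ^ 2)) ≤ 1 := by
      rw [Real.exp_le_one_iff]
      have := hτ.1.le
      have : 0 ≤ τ * (4 * π ^ 2) * ‖ξ‖ ^ 2 := by positivity
      linarith
    have h2 := psi_norm E τ
    calc ‖psi E τ‖ * (4 * π ^ 2 * ‖ξ‖ ^ 2 * rexp (-(τ * (4 * π ^ 2) * ‖ξ‖ ^ 2)) * ‖g ξ‖)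
        ≤ 1 * (4 * π ^ 2 * ‖ξ‖ ^ 2 * 1 * ‖g ξ‖) := by gcongr
      _ = 4 * π ^ 2 * (‖ξ‖ ^ 2 * ‖g ξ‖) := by ring

lemma hh_bd {E : ℝ} (hE : 0 < E) (ξ : V2) : ‖hh E ξ‖ ≤ 1 := by
  have h1 : ∀ s : ℝ, 0 < s → Real.exp (-(s * (4 * π ^ 2) * ‖ξ‖ ^ 2)) ≤ 1 := fun s hs => by
    rw [Real.exp_le_one_iff]
    have : 0 ≤ s * (4 * π ^ 2) * ‖ξ‖ ^ 2 := by positivity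
    linarith
  rw [hh, Real.norm_of_nonneg (by positivity)]
  have := h1 E hE
  have := h1 (3 * E) (by linarith)
  linarith

lemma hh_cont (E : ℝ) : Continuous (hh E) := by unfold hh; fun_prop

lemma hg_int (g : 𝓢(V2, F)) {E : ℝ} (hE : 0 < E) (x : V2) :
    Integrable (fun ξ => 𝐞 (inner ℝ ξ x) • (hh E ξ • g ξ)) := by
  have := g.continuous
  have h2 : Continuous fun ξ : V2 => 𝐞 (inner ℝ ξ x) :=
    continuous_fourierChar.comp (by fun_prop)
  have h3 := hh_cont E
  have h4 : Continuous fun ξ => hh E ξ • g ξ := by fun_prop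
  refine g.integrable.norm.mono' (h2.smul h4).aestronglyMeasurable ?_
  filter_upwards with ξ
  rw [Circle.norm_smul, norm_smul]
  exact mul_le_of_le_one_left (norm_nonneg _) (hh_bd hE ξ)

lemma B4 (g : 𝓢(V2, F)) {E : ℝ} (hE : 0 < E) (x : V2) :
    𝓕⁻ (g : V2 → F) x = 𝓕⁻ (fun ξ => hh E ξ • g ξ) x +
      ∫ τ in Set.Ioc 0 (3 * E), psi E τ • A g τ x := by
  have e : ∀ τ, psi E τ • A g τ x = ∫ ξ, psi E τ • (𝐞 (inner ℝ ξ x) • (mul τ ξ • g ξ)) := by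
    intro τ
    rw [integral_smul, A, Real.fourierInv_eq]
  have hi : Integrable (fun ξ => 𝐞 (inner ℝ ξ x) • g ξ) := by
    have h2 : Continuous fun ξ : V2 => 𝐞 (inner ℝ ξ x) :=
      continuous_fourierChar.comp (by fun_prop)
    refine g.integrable.norm.mono' (h2.smul g.continuous).aestronglyMeasurable ?_
    filter_upwards with ξ
    rw [Circle.norm_smul]
  have e2 : ∀ ξ, ∫ τ in Set.Ioc 0 (3 * E), psi E τ • (𝐞 (inner ℝ ξ x) • (mul τ ξ • g ξ)) =
      𝐞 (inner ℝ ξ x) • g ξ - 𝐞 (inner ℝ ξ x) • (hh E ξ • g ξ) := by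
    intro ξ
    have : ∀ τ, psi E τ • (𝐞 (inner ℝ ξ x) • (mul τ ξ • g ξ)) =
      (psi E τ * mul τ ξ) • (𝐞 (inner ℝ ξ x) • g ξ) := fun τ => by
        rw [smul_comm _ (mul τ ξ), smul_smul]
    simp_rw [this]
    rw [integral_smul_const, int_psi_mul hE, sub_smul, one_smul, smul_comm]
  simp_rw [e]
  rw [integral_integral_swap (B4_int g E x)]
  simp_rw [e2]
  rw [integral_sub hi (hg_int g hE x), Real.fourierInv_eq, Real.fourierInv_eq]
  abel

lemma B5 (g : 𝓢(V2, F)) {E : ℝ} (hE : 0 < E) (x : V2) :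
    ‖∫ τ in Set.Ioc 0 (3 * E), psi E τ • A g τ x‖ₑ ^ 2 ≤
      ENNReal.ofReal (3 / 2 * E) * ∫⁻ τ in Set.Ioi (0:ℝ), ‖A g τ x‖ₑ ^ 2 := by
  have hA : Measurable fun τ => ‖A g τ x‖ₑ :=
    ((B3 g).comp_measurable (g := fun τ : ℝ => (τ, x)) (by fun_prop)).enorm
  have h1 : ‖∫ τ in Set.Ioc 0 (3 * E), psi E τ • A g τ x‖ₑ ≤
      ∫⁻ τ in Set.Ioc 0 (3 * E), ((fun τ => ‖psi E τ‖ₑ) * (fun τ => ‖A g τ x‖ₑ)) τ := by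
    refine (enorm_integral_le_lintegral_enorm _).trans (le_of_eq ?_)
    congr with τ
    simp [enorm_smul]
  have h2 := ENNReal.lintegral_mul_le_Lp_mul_Lq (volume.restrict (Set.Ioc 0 (3 * E)))
    Real.HolderConjugate.two_two (psi_meas E).enorm.aemeasurable hA.aemeasurable
  have h3 := pow_le_pow_left' (h1.trans h2) 2
  refine h3.trans ?_
  rw [mul_pow, ← ENNReal.rpow_natCast, ← ENNReal.rpow_natCast, ← ENNReal.rpow_mul,
    ← ENNReal.rpow_mul]
  norm_num
  rw [lint_psi hE]
  refine mul_le_mul' (by rw [← ENNReal.ofReal_mul (by norm_num)]) (lintegral_mono_set ?_)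
  exact Set.Ioc_subset_Ioi_self


abbrev F2 := EuclideanSpace ℂ (Fin 2)

lemma gauss_int {b : ℝ} (hb : 0 < b) :
    ∫ ξ : V2, Real.exp (-(b * ‖ξ‖ ^ 2)) = π / b := by
  have := GaussianFourier.integral_rexp_neg_mul_sq_norm (V := V2) hb
  simpa [neg_mul] using this

lemma gauss_integrable {b : ℝ} (hb : 0 < b) :
    Integrable fun ξ : V2 => Real.exp (-(b * ‖ξ‖ ^ 2)) := by
  by_contra h
  have := gauss_int hb
  rw [integral_undef h] at this
  have : 0 < π / b := by positivity
  linarith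

lemma hh_sq (E : ℝ) (ξ : V2) : hh E ξ ^ 2 =
    1 / 4 * Real.exp (-(8 * π ^ 2 * E * ‖ξ‖ ^ 2)) + 1 / 4 * Real.exp (-(24 * π ^ 2 * E * ‖ξ‖ ^ 2))
      + 1 / 2 * Real.exp (-(16 * π ^ 2 * E * ‖ξ‖ ^ 2)) := by
  have h1 : -(8 * π ^ 2 * E * ‖ξ‖ ^ 2) = -(E * (4 * π ^ 2) * ‖ξ‖ ^ 2) + -(E * (4 * π ^ 2) * ‖ξ‖ ^ 2) := by ring
  have h2 : -(24 * π ^ 2 * E * ‖ξ‖ ^ 2) = -(3 * E * (4 * π ^ 2) * ‖ξ‖ ^ 2) + -(3 * E * (4 * π ^ 2) * ‖ξ‖ ^ 2) := by ring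
  have h3 : -(16 * π ^ 2 * E * ‖ξ‖ ^ 2) = -(E * (4 * π ^ 2) * ‖ξ‖ ^ 2) + -(3 * E * (4 * π ^ 2) * ‖ξ‖ ^ 2) := by ring
  rw [h1, h2, h3, Real.exp_add, Real.exp_add, Real.exp_add, hh]
  ring

lemma hh_sq_integrable {E : ℝ} (hE : 0 < E) : Integrable fun ξ : V2 => hh E ξ ^ 2 := by
  simp_rw [hh_sq]
  have := Real.pi_pos
  exact (((gauss_integrable (by positivity)).const_mul _).add
    ((gauss_integrable (by positivity)).const_mul _)).add
    ((gauss_integrable (by positivity)).const_mul _)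

lemma hh_sq_int {E : ℝ} (hE : 0 < E) : ∫ ξ : V2, hh E ξ ^ 2 = 7 / (96 * π * E) := by
  simp_rw [hh_sq]
  have := Real.pi_pos
  have i1 := gauss_integrable (b := 8 * π ^ 2 * E) (by positivity)
  have i2 := gauss_integrable (b := 24 * π ^ 2 * E) (by positivity)
  have i3 := gauss_integrable (b := 16 * π ^ 2 * E) (by positivity)
  have i12 : Integrable fun ξ : V2 => 1 / 4 * Real.exp (-(8 * π ^ 2 * E * ‖ξ‖ ^ 2)) +
      1 / 4 * Real.exp (-(24 * π ^ 2 * E * ‖ξ‖ ^ 2)) := (i1.const_mul _).add (i2.const_mul _)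
  rw [integral_add i12 (i3.const_mul _),
    integral_add (i1.const_mul _) (i2.const_mul _), integral_const_mul, integral_const_mul,
    integral_const_mul, gauss_int (by positivity), gauss_int (by positivity),
    gauss_int (by positivity)]
  field_simp
  norm_num

lemma memLp_hh {E : ℝ} (hE : 0 < E) : MemLp (hh E) 2 := by
  rw [memLp_two_iff_integrable_sq (hh_cont E).aestronglyMeasurable]
  exact hh_sq_integrable hE

noncomputable def perp (ξ : V2) : F2 := !₂[-(ξ 1 : ℂ), (ξ 0 : ℂ)]

lemma norm_perp (ξ : V2) : ‖perp ξ‖ = ‖ξ‖ := by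
  simp [perp, EuclideanSpace.norm_eq, Fin.sum_univ_two, add_comm]

lemma perp_sum (ξ : V2) : ‖perp ξ 0‖ ^ 2 + ‖perp ξ 1‖ ^ 2 = ‖ξ‖ ^ 2 := by
  rw [← norm_perp, EuclideanSpace.norm_sq_eq, Fin.sum_univ_two]

lemma perp_cont : Continuous perp := by
  unfold perp
  refine (PiLp.continuous_toLp 2 _).comp (continuous_pi fun i => ?_)
  fin_cases i <;> simp <;> fun_prop

noncomputable def Hk (E : ℝ) (x : V2) (k : Fin 2) (ξ : V2) : F2 :=
  (star (𝐞 (inner ℝ ξ x) : ℂ) * hh E ξ * (perp ξ k / ‖ξ‖ ^ 2)) • perp ξ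

lemma Hk_norm (E : ℝ) (x : V2) (k : Fin 2) (ξ : V2) :
    ‖Hk E x k ξ‖ ^ 2 = hh E ξ ^ 2 * (‖perp ξ k‖ ^ 2 / ‖ξ‖ ^ 2) := by
  by_cases h : ξ = 0
  · simp [h, Hk]
  have hn : ‖ξ‖ ≠ 0 := norm_ne_zero_iff.2 h
  rw [Hk, norm_smul, norm_mul, norm_mul, norm_div, norm_star, Circle.norm_coe, norm_perp]
  simp only [Complex.norm_real, norm_pow, one_mul, mul_pow, div_pow, Real.norm_eq_abs,
    sq_abs]
  field_simp

lemma Hk_meas (E : ℝ) (x : V2) (k : Fin 2) : Measurable (Hk E x k) := by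
  have h2 : Continuous fun ξ : V2 => (𝐞 (inner ℝ ξ x) : ℂ) :=
    continuous_subtype_val.comp (continuous_fourierChar.comp (by fun_prop))
  have h3 := hh_cont E
  have h4 := perp_cont
  have h5 : Continuous fun ξ => perp ξ k := by fun_prop
  unfold Hk
  have : Measurable fun ξ : V2 => star (𝐞 (inner ℝ ξ x) : ℂ) * hh E ξ * (perp ξ k / ‖ξ‖ ^ 2) := ?_
  · exact this.smul h4.measurable
  refine Measurable.mul (h2.star.measurable.mul (Complex.continuous_ofReal.comp h3).measurable) ?_
  refine h5.measurable.div ?_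
  exact Continuous.measurable (by fun_prop)

lemma Hk_memLp {E : ℝ} (hE : 0 < E) (x : V2) (k : Fin 2) : MemLp (Hk E x k) 2 := by
  refine (memLp_hh hE).of_le (Hk_meas E x k).aestronglyMeasurable ?_
  filter_upwards with ξ
  refine le_of_sq_le_sq ?_ (norm_nonneg _)
  rw [Hk_norm, Real.norm_eq_abs, sq_abs]
  refine mul_le_of_le_one_right (sq_nonneg _) ?_
  refine div_le_one_of_le₀ ?_ (sq_nonneg _)
  rw [← perp_sum]
  fin_cases k <;> simp

lemma inner_Hk (E : ℝ) (x : V2) (k : Fin 2) {ξ : V2} (hξ : ξ ≠ 0) (w : F2)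
    (hw : (ξ 0 : ℂ) * w 0 + (ξ 1 : ℂ) * w 1 = 0) :
    inner ℂ w (Hk E x k ξ) = star ((𝐞 (inner ℝ ξ x) • (hh E ξ • w)) k) := by
  have hn : (‖ξ‖ : ℂ) ^ 2 = (ξ 0 : ℂ) ^ 2 + (ξ 1 : ℂ) ^ 2 := by
    rw [← Complex.ofReal_pow, EuclideanSpace.norm_sq_eq, Fin.sum_univ_two]
    simp [← Complex.ofReal_pow]
  have hn0 : (ξ 0 : ℂ) ^ 2 + (ξ 1 : ℂ) ^ 2 ≠ 0 := by
    rw [← hn]; simpa using hξ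
  have key : (perp ξ k / ‖ξ‖ ^ 2) * inner ℂ w (perp ξ) = star (w k) := by
    have hw' : (ξ 0 : ℂ) * star (w 0) + (ξ 1 : ℂ) * star (w 1) = 0 := by
      have := congrArg star hw
      simpa using this
    rw [hn]
    simp only [perp, PiLp.inner_apply, Fin.sum_univ_two, RCLike.inner_apply]
    fin_cases k
    · simp at hw' ⊢
      field_simp
      linear_combination (-(ξ 0 : ℂ)) * hw'
    · simp at hw' ⊢
      field_simp
      linear_combination (-(ξ 1 : ℂ)) * hw'
  rw [Hk, inner_smul_right, mul_assoc, key]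
  simp [Circle.smul_def]
  ring

lemma bessel {m : ℕ} (G : Fin m → 𝓢(V2, F2))
    (ho : ∀ j k, ∫ ξ, inner ℂ (G j ξ) (G k ξ) = if j = k then (1 : ℂ) else 0)
    (hd : ∀ j (ξ : V2), (ξ 0 : ℂ) * G j ξ 0 + (ξ 1 : ℂ) * G j ξ 1 = 0)
    {E : ℝ} (hE : 0 < E) (x : V2) :
    ∑ j, ‖𝓕⁻ (fun ξ => hh E ξ • G j ξ) x‖ ^ 2 ≤ 7 / (96 * π * E) := by
  have hon : Orthonormal ℂ (fun j => (G j).toLp 2 volume) := by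
    rw [orthonormal_iff_ite]
    intro i j
    rw [← ho i j]
    exact SchwartzMap.inner_toL2_toL2_eq (G i) (G j) volume
  have h1 : ∀ k : Fin 2, ∑ j, ‖𝓕⁻ (fun ξ => hh E ξ • G j ξ) x k‖ ^ 2 ≤
      ∫ ξ, ‖Hk E x k ξ‖ ^ 2 := by
    intro k
    have hb := hon.sum_inner_products_le ((Hk_memLp hE x k).toLp _) (s := Finset.univ)
    have e1 : ‖(Hk_memLp hE x k).toLp (Hk E x k)‖ ^ 2 = ∫ ξ, ‖Hk E x k ξ‖ ^ 2 := by
      have := L2.integral_inner_eq_sq_eLpNorm (𝕜 := ℂ) ((Hk_memLp hE x k).toLp (Hk E x k))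
      have h2 := @norm_sq_eq_re_inner ℂ _ _ _ _ ((Hk_memLp hE x k).toLp (Hk E x k))
      rw [h2, L2.inner_def, ← integral_re]
      · refine integral_congr_ae ?_
        filter_upwards [(Hk_memLp hE x k).coeFn_toLp] with ξ hξ
        rw [hξ, ← norm_sq_eq_re_inner]
      · exact L2.integrable_inner _ _
    have e2 : ∀ j, inner ℂ ((G j).toLp 2 volume) ((Hk_memLp hE x k).toLp (Hk E x k)) =
        star (𝓕⁻ (fun ξ => hh E ξ • G j ξ) x k) := by
      intro j
      rw [L2.inner_def, Real.fourierInv_eq]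
      have := ContinuousLinearMap.integral_comp_comm (EuclideanSpace.proj (𝕜 := ℂ) k)
        (hg_int (G j) hE x)
      have this : ∫ ξ, (𝐞 (inner ℝ ξ x) • (hh E ξ • G j ξ)) k =
        (∫ ξ, 𝐞 (inner ℝ ξ x) • (hh E ξ • G j ξ)) k := this
      rw [← this]
      rw [show star (∫ ξ, (𝐞 (inner ℝ ξ x) • (hh E ξ • G j ξ)) k) =
        ∫ ξ, star ((𝐞 (inner ℝ ξ x) • (hh E ξ • G j ξ)) k) from integral_conj.symm]
      refine integral_congr_ae ?_
      filter_upwards [(Hk_memLp hE x k).coeFn_toLp, (G j).coeFn_toLp 2 volume,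
        Measure.ae_ne volume (0 : V2)] with ξ h1 h2 h3
      rw [h1, h2, inner_Hk E x k h3 _ (hd j ξ)]
    simp_rw [e2, norm_star, e1] at hb
    exact hb
  calc ∑ j, ‖𝓕⁻ (fun ξ => hh E ξ • G j ξ) x‖ ^ 2
      = ∑ k, ∑ j, ‖𝓕⁻ (fun ξ => hh E ξ • G j ξ) x k‖ ^ 2 := by
        rw [Finset.sum_comm]
        simp_rw [EuclideanSpace.norm_sq_eq]
    _ ≤ ∑ k, ∫ ξ, ‖Hk E x k ξ‖ ^ 2 := Finset.sum_le_sum fun k _ => h1 k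
    _ = ∫ ξ, ∑ k, ‖Hk E x k ξ‖ ^ 2 := by
        rw [integral_finsetSum]
        intro k _
        exact (memLp_two_iff_integrable_sq_norm (Hk_memLp hE x k).1).1 (Hk_memLp hE x k)
    _ ≤ ∫ ξ, hh E ξ ^ 2 := by
        refine integral_mono_of_nonneg (Filter.Eventually.of_forall fun ξ => by positivity)
          (hh_sq_integrable hE) (Filter.Eventually.of_forall fun ξ => ?_)
        simp only [Hk_norm, Fin.sum_univ_two]
        rw [← mul_add, ← add_div, perp_sum]
        exact mul_le_of_le_one_right (sq_nonneg _) (div_self_le_one _)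
    _ = _ := hh_sq_int hE


noncomputable def iotaL : V2 →L[ℝ] F2 :=
  LinearMap.toContinuousLinearMap
    { toFun := fun y => WithLp.toLp 2 (fun k => (y k : ℂ))
      map_add' := fun y z => by ext k; simp
      map_smul' := fun r y => by ext k; simp }

@[simp] lemma iotaL_apply (y : V2) (k : Fin 2) : iotaL y k = (y k : ℂ) := rfl

lemma norm_iotaL (y : V2) : ‖iotaL y‖ = ‖y‖ := by
  simp [EuclideanSpace.norm_eq]

lemma inner_iotaL (y z : V2) : inner ℂ (iotaL y) (iotaL z) = ((inner ℝ y z : ℝ) : ℂ) := by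
  simp [PiLp.inner_apply]

noncomputable def Wf (u : V2 → V2) (hs : ContDiff ℝ (⊤ : ℕ∞) u) (hc : HasCompactSupport u) :
    𝓢(V2, F2) :=
  HasCompactSupport.toSchwartzMap (f := fun x => iotaL (u x))
    (hc.comp_left (map_zero iotaL)) (iotaL.contDiff.comp hs)

open LineDeriv in
lemma lineDeriv_Wf (u : V2 → V2) (hs : ContDiff ℝ (⊤ : ℕ∞) u) (hc : HasCompactSupport u)
    (m x : V2) : (∂_{m} (Wf u hs hc)) x = iotaL (fderiv ℝ u x m) := by
  rw [SchwartzMap.lineDerivOp_apply_eq_fderiv]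
  have h : HasFDerivAt (fun x => iotaL (u x)) (iotaL.comp (fderiv ℝ u x)) x :=
    iotaL.hasFDerivAt.comp x ((hs.differentiable (by simp)) x).hasFDerivAt
  have h2 : fderiv ℝ (Wf u hs hc) x = iotaL.comp (fderiv ℝ u x) := h.fderiv
  rw [h2]; rfl

open LineDeriv in
lemma fourier_lineDeriv_Wf (f : 𝓢(V2, F2)) (i : Fin 2) (ξ : V2) :
    𝓕 (∂_{euclBasis i} f) ξ = (2 * π * Complex.I * (ξ i : ℂ)) • 𝓕 f ξ := by
  rw [SchwartzMap.fourier_lineDerivOp_eq, smul_apply,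
    smulLeftCLM_apply_apply (hasTemperateGrowth_inner_left _)]
  have e : (inner ℝ ξ (euclBasis i) : ℝ) = ξ i := by
    simp [euclBasis, EuclideanSpace.inner_single_right]
  rw [e]
  ext k
  simp
  ring

open LineDeriv in
lemma div_Wf (u : V2 → V2) (hs : ContDiff ℝ (⊤ : ℕ∞) u) (hc : HasCompactSupport u)
    (hdiv : ∀ x, fderiv ℝ u x (euclBasis 0) 0 + fderiv ℝ u x (euclBasis 1) 1 = 0) (ξ : V2) :
    (ξ 0 : ℂ) * 𝓕 (Wf u hs hc) ξ 0 + (ξ 1 : ℂ) * 𝓕 (Wf u hs hc) ξ 1 = 0 := by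
  have hInt : ∀ i, Integrable
      (fun x => 𝐞 (-inner ℝ x ξ) • (∂_{euclBasis i} (Wf u hs hc)) x) := fun i => by
    have h2 : Continuous fun x : V2 => 𝐞 (-inner ℝ x ξ) :=
      continuous_fourierChar.comp (by fun_prop)
    refine (∂_{euclBasis i} (Wf u hs hc)).integrable.norm.mono'
      (h2.smul (SchwartzMap.continuous _)).aestronglyMeasurable ?_
    filter_upwards with x
    rw [Circle.norm_smul]
  have hcomp : ∀ i k : Fin 2, 𝓕 (∂_{euclBasis i} (Wf u hs hc)) ξ k =
      ∫ x, (𝐞 (-inner ℝ x ξ) : ℂ) * (fderiv ℝ u x (euclBasis i) k : ℂ) := by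
    intro i k
    rw [SchwartzMap.fourier_coe, Real.fourier_eq]
    have := ContinuousLinearMap.integral_comp_comm (EuclideanSpace.proj (𝕜 := ℂ) k) (hInt i)
    refine Eq.trans this.symm ?_
    congr with x
    simp [lineDeriv_Wf, Circle.smul_def]
  have hi2 : ∀ i k : Fin 2, Integrable
      (fun x => (𝐞 (-inner ℝ x ξ) : ℂ) * (fderiv ℝ u x (euclBasis i) k : ℂ)) := by
    intro i k
    have := (EuclideanSpace.proj (𝕜 := ℂ) k).integrable_comp (hInt i)
    refine this.congr (Filter.Eventually.of_forall fun x => ?_)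
    simp [lineDeriv_Wf, Circle.smul_def]
  have h0 : 𝓕 (∂_{euclBasis 0} (Wf u hs hc)) ξ 0 + 𝓕 (∂_{euclBasis 1} (Wf u hs hc)) ξ 1 = 0 := by
    rw [hcomp, hcomp, ← integral_add (hi2 0 0) (hi2 1 1)]
    rw [integral_eq_zero_of_ae]
    filter_upwards with x
    rw [← mul_add, ← Complex.ofReal_add, hdiv x]
    simp
  rw [fourier_lineDeriv_Wf, fourier_lineDeriv_Wf] at h0
  simp only [PiLp.smul_apply, smul_eq_mul] at h0
  have h2 : (2 * π * Complex.I : ℂ) ≠ 0 := by simp [Real.pi_ne_zero]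
  apply mul_left_cancel₀ h2
  linear_combination h0

open LineDeriv in
lemma kin_Wf (u : V2 → V2) (hs : ContDiff ℝ (⊤ : ℕ∞) u) (hc : HasCompactSupport u) :
    ∫⁻ ξ, ENNReal.ofReal (2 * π ^ 2 * ‖ξ‖ ^ 2 * ‖𝓕 (Wf u hs hc) ξ‖ ^ 2) =
      ENNReal.ofReal (1 / 2 * ∫ x, ∑ i, ∑ k, (fderiv ℝ u x (euclBasis i) k) ^ 2) := by
  have hI : ∀ f : 𝓢(V2, F2), Integrable fun x => ‖f x‖ ^ 2 := fun f =>
    (memLp_two_iff_integrable_sq_norm f.continuous.aestronglyMeasurable).1 (f.memLp 2)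
  have e1 : ∀ i x, ∑ k, (fderiv ℝ u x (euclBasis i) k) ^ 2 =
      ‖(∂_{euclBasis i} (Wf u hs hc)) x‖ ^ 2 := by
    intro i x
    rw [lineDeriv_Wf, norm_iotaL, EuclideanSpace.norm_sq_eq]
    simp
  have e2 : ∀ i (ξ : V2), ‖𝓕 (∂_{euclBasis i} (Wf u hs hc)) ξ‖ ^ 2 =
      4 * π ^ 2 * (ξ i) ^ 2 * ‖𝓕 (Wf u hs hc) ξ‖ ^ 2 := by
    intro i ξ
    rw [fourier_lineDeriv_Wf, norm_smul, mul_pow]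
    simp [mul_pow]
    norm_num
  simp_rw [e1]
  rw [integral_finsetSum _ (fun i _ => hI _)]
  simp_rw [← integral_norm_sq_fourier (∂_{_} (Wf u hs hc))]
  rw [← integral_finsetSum _ (fun i _ => hI _), ← integral_const_mul,
    ofReal_integral_eq_lintegral_ofReal]
  · congr with ξ
    congr 1
    simp_rw [e2, Fin.sum_univ_two]
    rw [EuclideanSpace.norm_sq_eq ξ, Fin.sum_univ_two]
    simp
    ring
  · exact (integrable_finsetSum _ (fun i _ => hI _)).const_mul _
  · exact Filter.Eventually.of_forall fun x => by positivity

lemma pointwise {m : ℕ} (G : Fin m → 𝓢(V2, F2))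
    (ho : ∀ j k, ∫ ξ, inner ℂ (G j ξ) (G k ξ) = if j = k then (1 : ℂ) else 0)
    (hd : ∀ j (ξ : V2), (ξ 0 : ℂ) * G j ξ 0 + (ξ 1 : ℂ) * G j ξ 1 = 0) (x : V2) :
    ENNReal.ofReal ((∑ j, ‖𝓕⁻ (G j : V2 → F2) x‖ ^ 2) ^ 2) ≤
      ENNReal.ofReal (7 / (4 * π)) * ∑ j, ∫⁻ τ in Set.Ioi (0:ℝ), ‖A (G j) τ x‖ₑ ^ 2 := by
  set ρ := ∑ j, ‖𝓕⁻ (G j : V2 → F2) x‖ ^ 2 with hρ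
  have hρ0 : 0 ≤ ρ := Finset.sum_nonneg fun j _ => by positivity
  rcases hρ0.eq_or_lt with h | h
  · rw [← h]; simp
  have hpi := Real.pi_pos
  set E : ℝ := 7 / (24 * π * ρ) with hEdef
  have hE : 0 < E := by positivity
  have hb := bessel G ho hd hE x
  have hbE : 7 / (96 * π * E) = ρ / 4 := by rw [hEdef]; field_simp; norm_num
  rw [hbE] at hb
  set p := fun j => 𝓕⁻ (fun ξ => hh E ξ • G j ξ) x
  set q := fun j => ∫ τ in Set.Ioc 0 (3 * E), psi E τ • A (G j) τ x with hq
  have h1 : ρ ≤ ∑ j, (2 * ‖p j‖ ^ 2 + 2 * ‖q j‖ ^ 2) := by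
    refine Finset.sum_le_sum fun j _ => ?_
    rw [B4 (G j) hE x]
    have := norm_add_le (p j) (q j)
    calc ‖p j + q j‖ ^ 2 ≤ (‖p j‖ + ‖q j‖) ^ 2 := by gcongr
      _ ≤ _ := by nlinarith [sq_nonneg (‖p j‖ - ‖q j‖)]
  rw [Finset.sum_add_distrib, ← Finset.mul_sum, ← Finset.mul_sum] at h1
  have h2 : ρ ≤ 4 * ∑ j, ‖q j‖ ^ 2 := by
    have : ∑ j, ‖p j‖ ^ 2 ≤ ρ / 4 := hb
    linarith
  have h3 : ENNReal.ofReal (∑ j, ‖q j‖ ^ 2) ≤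
      ENNReal.ofReal (3 / 2 * E) * ∑ j, ∫⁻ τ in Set.Ioi (0:ℝ), ‖A (G j) τ x‖ₑ ^ 2 := by
    rw [ENNReal.ofReal_sum_of_nonneg (fun j _ => by positivity), Finset.mul_sum]
    refine Finset.sum_le_sum fun j _ => ?_
    rw [ENNReal.ofReal_pow (norm_nonneg _), ofReal_norm]
    exact B5 (G j) hE x
  calc ENNReal.ofReal (ρ ^ 2) ≤ ENNReal.ofReal (ρ * 4 * ∑ j, ‖q j‖ ^ 2) := by
        apply ENNReal.ofReal_le_ofReal; nlinarith
    _ = ENNReal.ofReal (ρ * 4) * ENNReal.ofReal (∑ j, ‖q j‖ ^ 2) :=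
        ENNReal.ofReal_mul (by positivity)
    _ ≤ ENNReal.ofReal (ρ * 4) * (ENNReal.ofReal (3 / 2 * E) *
        ∑ j, ∫⁻ τ in Set.Ioi (0:ℝ), ‖A (G j) τ x‖ₑ ^ 2) := mul_le_mul' le_rfl h3
    _ = _ := by
        rw [← mul_assoc, ← ENNReal.ofReal_mul (by positivity)]
        congr 2
        rw [hEdef]; field_simp; norm_num

lemma const_le : 7 / (8 * π) ≤ 1 / (2 * Real.sqrt 3) := by
  have h3 : Real.sqrt 3 ≤ 1.74 := by
    rw [Real.sqrt_le_left (by norm_num)]; norm_num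
  have hpi := Real.pi_gt_d2
  have : 0 < Real.sqrt 3 := by positivity
  rw [div_le_div_iff₀ (by positivity) (by positivity)]
  linarith

end LTaux

/-- Lieb–Thirring inequality for an `L²`-orthonormal family of smooth compactly
supported divergence-free vector fields `v₁, …, v_m : ℝ² → ℝ²`:
`∫ ρ(x)² dx ≤ (1/(2√3)) Σ_j ‖∇v_j‖²` where `ρ(x) = Σ_j ‖v_j(x)‖²`. -/
theorem lieb_thirring_div_free
    (m : ℕ) (v : Fin m → (EuclideanSpace ℝ (Fin 2) → EuclideanSpace ℝ (Fin 2)))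
    (hsmooth : ∀ j, ContDiff ℝ (⊤ : ℕ∞) (v j))
    (hsupp : ∀ j, HasCompactSupport (v j))
    (horth : ∀ j k, (∫ x, ⟪v j x, v k x⟫) = if j = k then (1 : ℝ) else 0)
    (hdiv : ∀ j x, fderiv ℝ (v j) x (euclBasis 0) 0 + fderiv ℝ (v j) x (euclBasis 1) 1 = 0) :
    (∫ x, (∑ j, ‖v j x‖ ^ 2) ^ 2) ≤
      (1 / (2 * Real.sqrt 3)) *
        ∑ j, ∫ x, ∑ i, ∑ k, (fderiv ℝ (v j) x (euclBasis i) k) ^ 2 := by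
  open LTaux FourierTransform in
  let W := fun j => Wf (v j) (hsmooth j) (hsupp j)
  have hWx : ∀ j x, W j x = iotaL (v j x) := fun j x => rfl
  have ho : ∀ j k, ∫ ξ, inner ℂ (𝓕 (W j) ξ) (𝓕 (W k) ξ) = if j = k then (1 : ℂ) else 0 := by
    intro j k
    rw [SchwartzMap.integral_inner_fourier_fourier]
    simp_rw [hWx, inner_iotaL]
    rw [integral_complex_ofReal, horth j k]
    split_ifs <;> simp
  have hd : ∀ j (ξ : V2), (ξ 0 : ℂ) * 𝓕 (W j) ξ 0 + (ξ 1 : ℂ) * 𝓕 (W j) ξ 1 = 0 :=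
    fun j ξ => div_Wf (v j) (hsmooth j) (hsupp j) (hdiv j) ξ
  have hinv : ∀ j x, ‖𝓕⁻ (⇑(𝓕 (W j) : SchwartzMap V2 F2) : V2 → F2) x‖ = ‖v j x‖ := by
    intro j x
    rw [← norm_iotaL (v j x), ← hWx, ← SchwartzMap.fourierInv_coe, FourierTransform.fourierInv_fourier_eq]
  have hp := pointwise (fun j => 𝓕 (W j)) ho hd
  simp only [hinv] at hp
  set D := fun j => ∫ x, ∑ i, ∑ k, (fderiv ℝ (v j) x (euclBasis i) k) ^ 2 with hD
  have hD0 : ∀ j, 0 ≤ D j := fun j => integral_nonneg fun x => by positivity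
  have hcont : ∀ j, Continuous (v j) := fun j => (hsmooth j).continuous
  have hS : 0 ≤ ∑ j, D j := Finset.sum_nonneg fun j _ => hD0 j
  have hpi := Real.pi_pos
  have main : (∫ x, (∑ j, ‖v j x‖ ^ 2) ^ 2) ≤ 7 / (8 * Real.pi) * ∑ j, D j := by
    rw [integral_eq_lintegral_of_nonneg_ae (Filter.Eventually.of_forall fun x => by positivity)
      (Continuous.aestronglyMeasurable (by fun_prop))]
    refine ENNReal.toReal_le_of_le_ofReal (by positivity) ?_
    refine (lintegral_mono hp).trans ?_
    have hmeas : ∀ j, Measurable fun x : V2 =>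
        ∫⁻ τ in Set.Ioi (0:ℝ), ‖A (𝓕 (W j)) τ x‖ₑ ^ 2 := fun j =>
      Measurable.lintegral_prod_right'
        (f := fun z : V2 × ℝ => ‖A (𝓕 (W j)) z.2 z.1‖ₑ ^ 2)
        (((B3 (𝓕 (W j))).comp_measurable measurable_swap).enorm.pow_const 2)
    rw [lintegral_const_mul _ (Finset.measurable_fun_sum _ fun j _ => hmeas j),
      lintegral_finsetSum _ fun j _ => hmeas j]
    simp_rw [B2]
    have hk : ∀ j, ∫⁻ ξ, ENNReal.ofReal (2 * Real.pi ^ 2 * ‖ξ‖ ^ 2 * ‖𝓕 (W j) ξ‖ ^ 2) =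
      ENNReal.ofReal (1 / 2 * D j) := fun j => kin_Wf (v j) (hsmooth j) (hsupp j)
    simp_rw [hk]
    rw [← ENNReal.ofReal_sum_of_nonneg (fun j _ => by have := hD0 j; positivity),
      ← ENNReal.ofReal_mul (by positivity), ← Finset.mul_sum]
    apply ENNReal.ofReal_le_ofReal
    apply le_of_eq
    field_simp
    ring
  exact main.trans (mul_le_mul_of_nonneg_right const_le hS)
end

section
/- (Existence of the global attractor for abstract semigroups.) Let H be a Banach space and let S(t) : H → H, t ≥ 0, be a semigroup of maps (S(0) = id and S(t+s) = S(t) ∘ S(s) for all t, s ≥ 0). Assume: (1) there is a bounded closed set B ⊆ H which is absorbing, i.e. for every bounded set B' ⊆ H there exists T = T(B') such that S(t)B' ⊆ B for all t ≥ T; (2) S is asymptotically compact, i.e. for every bounded sequence (u_n) in H and every sequence t_n → ∞, the sequence (S(t_n)u_n) has a convergent subsequence in H; (3) for every fixed t ≥ 0 the map S(t) : B → H is continuous. Then there exists a set A ⊆ B such that: A is compact in H; A is strictly invariant, S(t)A = A for all t ≥ 0; and A attracts bounded sets, i.e. for every bounded set B' ⊆ H and every open neighborhood O of A in H there exists T such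 that S(t)B' ⊆ O for all t ≥ T. -/
open Filter

/-- Existence of the global attractor for an abstract semigroup `S(t)` on a Banach
space `H` possessing a bounded closed absorbing set, which is asymptotically compact
and continuous on the absorbing set. The attractor `A` is compact, strictly
invariant and attracts bounded sets. -/
theorem exists_global_attractor
    {H : Type*} [NormedAddCommGroup H] [NormedSpace ℝ H] [CompleteSpace H]
    (S : ℝ → H → H)
    (hS0 : S 0 = id)
    (hSsemigroup : ∀ t ≥ (0 : ℝ), ∀ s ≥ (0 : ℝ), S (t + s) = S t ∘ S s)
    (B : Set H) (hBbdd : Bornology.IsBounded B) (hBclosed : IsClosed B)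
    (habsorbing : ∀ B' : Set H, Bornology.IsBounded B' →
      ∃ T : ℝ, ∀ t ≥ T, S t '' B' ⊆ B)
    (hasymcompact : ∀ u : ℕ → H, Bornology.IsBounded (Set.range u) →
      ∀ tn : ℕ → ℝ, Tendsto tn atTop atTop →
        ∃ φ : ℕ → ℕ, StrictMono φ ∧
          ∃ x : H, Tendsto (fun n => S (tn (φ n)) (u (φ n))) atTop (nhds x))
    (hcont : ∀ t ≥ (0 : ℝ), ContinuousOn (S t) B) :
    ∃ A ⊆ B, IsCompact A ∧ (∀ t ≥ (0 : ℝ), S t '' A = A) ∧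
      ∀ B' : Set H, Bornology.IsBounded B' →
        ∀ O : Set H, IsOpen O → A ⊆ O →
          ∃ T : ℝ, ∀ t ≥ T, S t '' B' ⊆ O := by
  let A : Set H := {x | ∀ ε > (0 : ℝ), ∀ T : ℝ, ∃ t ≥ T, ∃ b ∈ B, dist (S t b) x < ε}
  -- eventually orbits lie in the absorbing set
  have hev : ∀ u : ℕ → H, Bornology.IsBounded (Set.range u) → ∀ tn : ℕ → ℝ,
      Tendsto tn atTop atTop → ∀ᶠ n in atTop, S (tn n) (u n) ∈ B := by
    intro u hu tn htn
    obtain ⟨T, hT⟩ := habsorbing _ hu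
    filter_upwards [htn.eventually_ge_atTop T] with n hn
    exact hT _ hn ⟨u n, ⟨n, rfl⟩, rfl⟩
  -- limits belong to A
  have hlim : ∀ u : ℕ → H, Bornology.IsBounded (Set.range u) → ∀ tn : ℕ → ℝ,
      Tendsto tn atTop atTop → ∀ x, Tendsto (fun n => S (tn n) (u n)) atTop (nhds x) →
      x ∈ A := by
    intro u hu tn htn x hx ε hε T'
    obtain ⟨T, hT⟩ := habsorbing _ hu
    have h1 := (Metric.tendsto_nhds.1 hx) ε hε
    obtain ⟨n, hn1, hn2, hn3⟩ := (h1.and ((htn.eventually_ge_atTop (T' + max T 0)).and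
      (htn.eventually_ge_atTop (max T 0)))).exists
    refine ⟨tn n - max T 0, by linarith, S (max T 0) (u n),
      hT _ (le_max_left _ _) ⟨u n, ⟨n, rfl⟩, rfl⟩, ?_⟩
    have h2 := hSsemigroup (tn n - max T 0) (by linarith) (max T 0) (le_max_right _ _)
    rw [sub_add_cancel] at h2
    rw [h2] at hn1
    exact hn1
  have hbd : ∀ (C : Set H), Bornology.IsBounded C → ∀ u : ℕ → H, (∀ n, u n ∈ C) →
      Bornology.IsBounded (Set.range u) := by
    intro C hC u hu
    exact hC.subset (Set.range_subset_iff.2 hu)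
  have hge : ∀ tn : ℕ → ℝ, (∀ n : ℕ, tn n ≥ (n : ℝ)) → Tendsto tn atTop atTop := by
    intro tn h
    exact tendsto_atTop_mono h tendsto_natCast_atTop_atTop
  -- sequences approximating points of A
  have happ : ∀ x : ℕ → H, (∀ n, x n ∈ A) → ∃ (u : ℕ → H) (tn : ℕ → ℝ),
      Bornology.IsBounded (Set.range u) ∧ Tendsto tn atTop atTop ∧
      Tendsto (fun n => dist (S (tn n) (u n)) (x n)) atTop (nhds 0) := by
    intro x hx
    have h := fun n : ℕ => hx n (1 / ((n : ℝ) + 1)) (by positivity) n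
    choose tn htn u hu hd using h
    refine ⟨u, tn, hbd B hBbdd u hu, hge tn htn, ?_⟩
    exact squeeze_zero (fun _ => dist_nonneg) (fun n => (hd n).le)
      tendsto_one_div_add_atTop_nhds_zero_nat
  have happ1 : ∀ x ∈ A, ∃ (u : ℕ → H) (tn : ℕ → ℝ),
      Bornology.IsBounded (Set.range u) ∧ Tendsto tn atTop atTop ∧
      Tendsto (fun n => S (tn n) (u n)) atTop (nhds x) := by
    intro x hx
    obtain ⟨u, tn, h1, h2, h3⟩ := happ (fun _ => x) (fun _ => hx)
    exact ⟨u, tn, h1, h2, tendsto_iff_dist_tendsto_zero.2 h3⟩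
  have hAB : A ⊆ B := by
    intro x hx
    obtain ⟨u, tn, h1, h2, h3⟩ := happ1 x hx
    exact hBclosed.mem_of_tendsto h3 (hev u h1 tn h2)
  have hsub : ∀ (u : ℕ → H) (φ : ℕ → ℕ), Bornology.IsBounded (Set.range u) →
      Bornology.IsBounded (Set.range (fun n => u (φ n))) := by
    intro u φ hu
    exact hbd _ hu _ (fun n => ⟨φ n, rfl⟩)
  -- pushing limits forward
  have hpush : ∀ u : ℕ → H, Bornology.IsBounded (Set.range u) → ∀ tn : ℕ → ℝ,
      Tendsto tn atTop atTop → ∀ x, Tendsto (fun n => S (tn n) (u n)) atTop (nhds x) →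
      ∀ t ≥ (0 : ℝ), Tendsto (fun n => S (t + tn n) (u n)) atTop (nhds (S t x)) := by
    intro u hu tn htn x hx t ht
    have hxB : x ∈ B := hAB (hlim u hu tn htn x hx)
    have h1 : Tendsto (fun n => S (tn n) (u n)) atTop (nhdsWithin x B) :=
      tendsto_nhdsWithin_iff.2 ⟨hx, hev u hu tn htn⟩
    have h2 : Tendsto (fun n => S t (S (tn n) (u n))) atTop (nhds (S t x)) :=
      Tendsto.comp (hcont t ht x hxB) h1
    refine h2.congr' ?_
    filter_upwards [htn.eventually_ge_atTop 0] with n hn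
    rw [hSsemigroup t ht (tn n) hn]
    rfl
  refine ⟨A, hAB, ?_, ?_, ?_⟩
  · apply IsSeqCompact.isCompact
    intro x hx
    obtain ⟨u, tn, h1, h2, h3⟩ := happ x hx
    obtain ⟨φ, hφ, y, hy⟩ := hasymcompact u h1 tn h2
    refine ⟨y, hlim _ (hsub u φ h1) _ (h2.comp hφ.tendsto_atTop) y hy, φ, hφ, ?_⟩
    exact (tendsto_iff_of_dist (h3.comp hφ.tendsto_atTop)).1 hy
  · intro t ht
    apply Set.Subset.antisymm
    · rintro _ ⟨x, hx, rfl⟩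
      obtain ⟨u, tn, h1, h2, h3⟩ := happ1 x hx
      exact hlim u h1 (fun n => t + tn n) (tendsto_atTop_add_const_left _ t h2) _
        (hpush u h1 tn h2 x h3 t ht)
    · intro x hx
      obtain ⟨u, tn, h1, h2, h3⟩ := happ1 x hx
      have h4 : Tendsto (fun n => tn n - t) atTop atTop := by
        simpa [sub_eq_add_neg] using tendsto_atTop_add_const_right _ (-t) h2
      obtain ⟨φ, hφ, y, hy⟩ := hasymcompact u h1 _ h4
      have h5 := h4.comp hφ.tendsto_atTop
      refine ⟨y, hlim _ (hsub u φ h1) _ h5 y hy, ?_⟩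
      have h6 := hpush _ (hsub u φ h1) _ h5 y hy t ht
      have h7 := h3.comp hφ.tendsto_atTop
      refine tendsto_nhds_unique h6 (h7.congr ?_)
      intro n
      simp
  · intro B' hB' O hO hAO
    by_contra! hcon
    have h : ∀ n : ℕ, ∃ t ≥ (n : ℝ), ∃ b ∈ B', S t b ∉ O := by
      intro n
      obtain ⟨t, ht, hn⟩ := hcon n
      obtain ⟨_, ⟨b, hb, rfl⟩, hbO⟩ := Set.not_subset.1 hn
      exact ⟨t, ht, b, hb, hbO⟩
    choose tn htn u hu hO' using h
    have h1 := hbd B' hB' u hu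
    have h2 := hge tn htn
    obtain ⟨φ, hφ, y, hy⟩ := hasymcompact u h1 tn h2
    have hyA := hlim _ (hsub u φ h1) _ (h2.comp hφ.tendsto_atTop) y hy
    obtain ⟨n, hn⟩ := (hy.eventually (hO.mem_nhds (hAO hyA))).exists
    exact hO' _ hn
end

section
/- (Orthogonality of the advection term to the Laplacian in 2D.) Let u : ℝ² → ℝ² be a smooth compactly supported vector field with div u = ∂_{x₁}u¹ + ∂_{x₂}u² = 0. Then ∫_{ℝ²} ⟨(u·∇)u, Δu⟩ dx = 0, where (u·∇)u = Σ_{i=1}^{2} u^i ∂_{x_i} u and Δu is the componentwise Laplacian. -/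
open MeasureTheory RealInnerProductSpace

theorem integral_fderiv_zero_aux (F : EuclideanSpace ℝ (Fin 2) → ℝ)
    (hF : ContDiff ℝ 1 F) (hs : HasCompactSupport F) (v : EuclideanSpace ℝ (Fin 2)) :
    Integrable (fun x => fderiv ℝ F x v) ∧ (∫ x, fderiv ℝ F x v) = 0 := by
  have hi : Integrable (fun x => fderiv ℝ F x v) :=
    ((hF.continuous_fderiv (by norm_num)).clm_apply continuous_const).integrable_of_hasCompactSupport
      (hs.fderiv_apply (𝕜 := ℝ) v)
  refine ⟨hi, ?_⟩
  have h := integral_mul_fderiv_eq_neg_fderiv_mul_of_integrable (𝕜 := ℝ) (μ := volume)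
    (f := fun _ : EuclideanSpace ℝ (Fin 2) => (1 : ℝ)) (g := F) (v := v)
    (by simp) (by simpa using hi)
    (by simpa using hF.continuous.integrable_of_hasCompactSupport hs)
    (by intro x; fun_prop) (fun x _ => hF.differentiable (by norm_num) x)
  simpa using h

/-- Partial derivative of component. -/
noncomputable def pd (u : EuclideanSpace ℝ (Fin 2) → EuclideanSpace ℝ (Fin 2)) (i j : Fin 2)
    (x : EuclideanSpace ℝ (Fin 2)) : ℝ := fderiv ℝ u x (euclBasis i) j

/-- Orthogonality of the advection term to the Laplacian in 2D: for a smooth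
compactly supported divergence-free vector field `u : ℝ² → ℝ²`,
`∫ ⟨(u·∇)u, Δu⟩ dx = 0`, where `Δu` is the componentwise Laplacian. -/
theorem advection_laplacian_orthogonality
    (u : EuclideanSpace ℝ (Fin 2) → EuclideanSpace ℝ (Fin 2))
    (hu : ContDiff ℝ (⊤ : ℕ∞) u) (hus : HasCompactSupport u)
    (hdiv : ∀ x, ∑ i, fderiv ℝ u x (euclBasis i) i = 0) :
    (∫ x, ⟪∑ i, u x i • fderiv ℝ u x (euclBasis i),
        ∑ i, fderiv ℝ (fun y => fderiv ℝ u y (euclBasis i)) x (euclBasis i)⟫) = 0 := by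
  have hu3 : ContDiff ℝ 3 u := by exact_mod_cast contDiff_infty.1 hu 3
  have hD : ContDiff ℝ 2 (fderiv ℝ u) := hu3.fderiv_right (by norm_num)
  have hDi : ∀ i, ContDiff ℝ 2 (fun y => fderiv ℝ u y (euclBasis i)) := fun i =>
    hD.clm_apply contDiff_const
  have hp : ∀ i j, ContDiff ℝ 2 (pd u i j) := fun i j => by
    have := contDiff_euclidean.1 (hDi i) j
    exact this
  have hc : ∀ j, ContDiff ℝ 2 (fun x => u x j) := fun j =>
    contDiff_euclidean.1 (hu3.of_le (by norm_num)) j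
  have hpd : ∀ i j, Differentiable ℝ (pd u i j) := fun i j => (hp i j).differentiable (by norm_num)
  have hcd : ∀ j, Differentiable ℝ (fun x => u x j) := fun j => (hc j).differentiable (by norm_num)
  have hcomp : ∀ (f : EuclideanSpace ℝ (Fin 2) → EuclideanSpace ℝ (Fin 2)) (x v) (j : Fin 2),
      DifferentiableAt ℝ f x → fderiv ℝ (fun y => f y j) x v = fderiv ℝ f x v j := by
    intro f x v j hf
    have := ((EuclideanSpace.proj j : EuclideanSpace ℝ (Fin 2) →L[ℝ] ℝ).hasFDerivAt (x := f x)).comp x hf.hasFDerivAt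
    have h2 : HasFDerivAt (fun y => f y j) _ x := this
    rw [h2.fderiv]; rfl
  have hcv : ∀ x i j, fderiv ℝ (fun y => u y j) x (euclBasis i) = pd u i j x := fun x i j =>
    hcomp u x _ j (hu3.differentiable (by norm_num) x)
  have hlap : ∀ x i j k, (fderiv ℝ (fun y => fderiv ℝ u y (euclBasis i)) x (euclBasis k)) j
      = fderiv ℝ (pd u i j) x (euclBasis k) := fun x i j k =>
    (hcomp _ x _ j ((hDi i).differentiable (by norm_num) x)).symm
  have hsec : ∀ x i k, fderiv ℝ (fun y => fderiv ℝ u y (euclBasis i)) x (euclBasis k)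
      = fderiv ℝ (fderiv ℝ u) x (euclBasis k) (euclBasis i) := fun x i k => by
    rw [fderiv_clm_apply (hD.differentiable (by norm_num) x) (by fun_prop)]
    simp
  have hsym : ∀ x i j k, fderiv ℝ (pd u i j) x (euclBasis k)
      = fderiv ℝ (pd u k j) x (euclBasis i) := fun x i j k => by
    rw [← hlap, ← hlap, hsec, hsec]
    have : IsSymmSndFDerivAt ℝ u x := hu3.contDiffAt.isSymmSndFDerivAt (by simp; norm_num)
    rw [this.eq]
  have hdv : ∀ x, pd u 0 0 x + pd u 1 1 x = 0 := fun x => by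
    have := hdiv x
    rwa [Fin.sum_univ_two] at this
  have hdv' : pd u 1 1 = fun x => - pd u 0 0 x := by
    funext x; linarith [hdv x]
  have hdq : ∀ x k, fderiv ℝ (pd u 1 1) x (euclBasis k) = - fderiv ℝ (pd u 0 0) x (euclBasis k) := by
    intro x k
    rw [hdv', fderiv_fun_neg]; rfl
  have hmul : ∀ (f g : EuclideanSpace ℝ (Fin 2) → ℝ) (x v), Differentiable ℝ f →
      Differentiable ℝ g → fderiv ℝ (fun y => f y * g y) x v
        = f x * fderiv ℝ g x v + g x * fderiv ℝ f x v := by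
    intro f g x v hf hg
    rw [fderiv_fun_mul (hf x) (hg x)]; simp
  have hadd : ∀ (f g : EuclideanSpace ℝ (Fin 2) → ℝ) (x v), Differentiable ℝ f →
      Differentiable ℝ g → fderiv ℝ (fun y => f y + g y) x v
        = fderiv ℝ f x v + fderiv ℝ g x v := by
    intro f g x v hf hg
    rw [fderiv_fun_add (hf x) (hg x)]; simp
  have hsub : ∀ (f g : EuclideanSpace ℝ (Fin 2) → ℝ) (x v), Differentiable ℝ f →
      Differentiable ℝ g → fderiv ℝ (fun y => f y - g y) x v
        = fderiv ℝ f x v - fderiv ℝ g x v := by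
    intro f g x v hf hg
    rw [fderiv_fun_sub (hf x) (hg x)]; simp
  -- vorticity and nonlinear terms
  let w : EuclideanSpace ℝ (Fin 2) → ℝ := fun x => pd u 0 1 x - pd u 1 0 x
  let N : Fin 2 → EuclideanSpace ℝ (Fin 2) → ℝ :=
    fun j x => u x 0 * pd u 0 j x + u x 1 * pd u 1 j x
  have hw : ContDiff ℝ 2 w := (hp 0 1).sub (hp 1 0)
  have hN : ∀ j, ContDiff ℝ 2 (N j) := fun j =>
    ((hc 0).mul (hp 0 j)).add ((hc 1).mul (hp 1 j))
  have hwd : Differentiable ℝ w := hw.differentiable (by norm_num)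
  have hNd : ∀ j, Differentiable ℝ (N j) := fun j => (hN j).differentiable (by norm_num)
  have hwv : ∀ x k, fderiv ℝ w x (euclBasis k) = fderiv ℝ (pd u 0 1) x (euclBasis k)
      - fderiv ℝ (pd u 1 0) x (euclBasis k) := fun x k => hsub _ _ x _ (hpd _ _) (hpd _ _)
  have hNv : ∀ j x k, fderiv ℝ (N j) x (euclBasis k) =
      (u x 0 * fderiv ℝ (pd u 0 j) x (euclBasis k) + pd u 0 j x * pd u k 0 x)
      + (u x 1 * fderiv ℝ (pd u 1 j) x (euclBasis k) + pd u 1 j x * pd u k 1 x) := fun j x k => by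
    refine (hadd (fun x => u x 0 * pd u 0 j x) (fun x => u x 1 * pd u 1 j x) x _
      ((hcd 0).mul (hpd 0 j)) ((hcd 1).mul (hpd 1 j))).trans ?_
    rw [hmul _ _ x _ (hcd 0) (hpd 0 j), hmul _ _ x _ (hcd 1) (hpd 1 j), hcv, hcv]
  let F : Fin 2 → Fin 2 → ℝ → EuclideanSpace ℝ (Fin 2) → ℝ := fun i j c x =>
    w x * (c * N j x - 1 / 2 * (u x i * w x))
  have hFc : ∀ i j c, ContDiff ℝ 2 (F i j c) := fun i j c =>
    hw.mul ((contDiff_const.mul (hN j)).sub (contDiff_const.mul ((hc i).mul hw)))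
  have hws : HasCompactSupport w := by
    have h1 : HasCompactSupport (fderiv ℝ u) := hus.fderiv (𝕜 := ℝ)
    refine h1.mono ?_
    intro x hx
    contrapose! hx
    simp only [Function.mem_support, not_not] at hx ⊢
    simp [w, pd, hx]
  have hFs : ∀ i j c, HasCompactSupport (F i j c) := fun i j c => hws.mul_right
  have hFv : ∀ i j c x k, fderiv ℝ (F i j c) x (euclBasis k) =
      w x * (c * fderiv ℝ (N j) x (euclBasis k)
        - 1 / 2 * (u x i * fderiv ℝ w x (euclBasis k) + w x * pd u k i x))
      + (c * N j x - 1 / 2 * (u x i * w x)) * fderiv ℝ w x (euclBasis k) := by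
    intro i j c x k
    have hcst : ∀ c : ℝ, Differentiable ℝ (fun _ : EuclideanSpace ℝ (Fin 2) => c) :=
      fun c => differentiable_const c
    have d1 : Differentiable ℝ (fun x => c * N j x) := (hcst c).mul (hNd j)
    have d2 : Differentiable ℝ (fun x => u x i * w x) := (hcd i).mul hwd
    have d3 : Differentiable ℝ (fun x => 1 / 2 * (u x i * w x)) := (hcst _).mul d2
    refine (hmul w (fun x => c * N j x - 1 / 2 * (u x i * w x)) x _ hwd (d1.sub d3)).trans ?_
    rw [hsub _ _ x _ d1 d3, hmul _ _ x _ (hcst _) (hNd j),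
      hmul _ _ x _ (hcst _) d2, hmul _ _ x _ (hcd i) hwd, hcv]
    simp
  obtain ⟨i0, z0⟩ := integral_fderiv_zero_aux (F 0 1 1) ((hFc _ _ _).of_le (by norm_num))
    (hFs _ _ _) (euclBasis 0)
  obtain ⟨i1, z1⟩ := integral_fderiv_zero_aux (F 1 0 (-1)) ((hFc _ _ _).of_le (by norm_num))
    (hFs _ _ _) (euclBasis 1)
  have key : ∀ x, ⟪∑ i, u x i • fderiv ℝ u x (euclBasis i),
        ∑ i, fderiv ℝ (fun y => fderiv ℝ u y (euclBasis i)) x (euclBasis i)⟫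
      = fderiv ℝ (F 0 1 1) x (euclBasis 0) + fderiv ℝ (F 1 0 (-1)) x (euclBasis 1) := by
    intro x
    have e : ⟪∑ i, u x i • fderiv ℝ u x (euclBasis i),
        ∑ i, fderiv ℝ (fun y => fderiv ℝ u y (euclBasis i)) x (euclBasis i)⟫
        = N 0 x * (fderiv ℝ (pd u 0 0) x (euclBasis 0) + fderiv ℝ (pd u 1 0) x (euclBasis 1))
        + N 1 x * (fderiv ℝ (pd u 0 1) x (euclBasis 0) + fderiv ℝ (pd u 1 1) x (euclBasis 1)) := by
      simp only [← hlap, N, pd]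
      simp only [PiLp.inner_apply, Fin.sum_univ_two, PiLp.add_apply, PiLp.smul_apply, smul_eq_mul,
        RCLike.inner_apply, conj_trivial]
      ring
    rw [e, hFv, hFv, hNv, hNv, hwv, hwv]
    have s1 := hsym x 0 0 1
    have s2 := hsym x 0 1 1
    have q0 := hdq x 0
    have q1 := hdq x 1
    have d : pd u 1 1 x = - pd u 0 0 x := by linarith [hdv x]
    rw [q0] at s2
    simp only [s2, q0, q1, ← s1, d, N, w]
    ring
  simp_rw [key]
  rw [integral_add i0 i1, z0, z1, add_zero]
end

section
/- (Trace estimate for the linearized damped Navier–Stokes operator.) Let u : ℝ² → ℝ² be a smooth vector field with ∫_{ℝ²} Σ_{i,j}(∂_{x_i}u^j)² dx < ∞ and div u = 0, and let v₁, …, v_m : ℝ² → ℝ² be smooth compactly supported divergence-free vector fields orthonormal in L²(ℝ²; ℝ²). Assume the Lieb–Thirring bound ∫_{ℝ²} (Σ_{j=1}^{m} ‖v_j(x)‖²)² dx ≤ (1/(2√3)) Σ_{j=1}^{m} ‖∇v_j‖²_{L²} holds (as it does for such families). Then Σ_{j=1}^{m} ( −‖∇v_j‖²_{L²} − ‖v_j‖²_{L²}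 − ∫_{ℝ²} ⟨(v_j·∇)u, v_j⟩ dx ) ≤ −m + (1/(16√3)) ‖∇u‖²_{L²}. -/
open MeasureTheory RealInnerProductSpace

theorem pointwise_bound (a b c d p q : ℝ) (h : a + d = 0) :
    -(p * (a * p + b * q) + q * (c * p + d * q)) ≤
      Real.sqrt ((a ^ 2 + b ^ 2 + (c ^ 2 + d ^ 2)) / 2) * (p ^ 2 + q ^ 2) := by
  have hd : d = -a := by linarith
  subst hd
  have hG : 0 ≤ (a ^ 2 + b ^ 2 + (c ^ 2 + (-a) ^ 2)) / 2 := by positivity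
  refine (abs_le_of_sq_le_sq' ?_ (by positivity)).2
  rw [mul_pow, Real.sq_sqrt hG]
  nlinarith [sq_nonneg ((b - c) * (p ^ 2 + q ^ 2)), sq_nonneg (2 * a * (2 * p * q) - (b + c) * (p ^ 2 - q ^ 2))]

theorem young_bound (G r : ℝ) (hG : 0 ≤ G) :
    Real.sqrt (G / 2) * r ≤ 2 * Real.sqrt 3 * r ^ 2 + 1 / (16 * Real.sqrt 3) * G := by
  have h3 : 0 < Real.sqrt 3 := by positivity
  have hs : Real.sqrt (G / 2) ^ 2 = G / 2 := Real.sq_sqrt (by positivity)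
  set t := Real.sqrt (G / 2)
  have hG' : G = 2 * t ^ 2 := by linarith
  rw [hG']
  have : 2 * Real.sqrt 3 * r ^ 2 + 1 / (16 * Real.sqrt 3) * (2 * t ^ 2) - t * r
      = (1 / (8 * Real.sqrt 3)) * (t - 4 * Real.sqrt 3 * r) ^ 2 := by
    field_simp
    ring
  have h2 : 0 ≤ (1 / (8 * Real.sqrt 3)) * (t - 4 * Real.sqrt 3 * r) ^ 2 := by positivity
  linarith

/-- Trace estimate for the linearized damped Navier–Stokes operator (with
`ν = α = 1`): for a smooth divergence-free field `u` with square-integrable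
gradient and an orthonormal family of smooth compactly supported divergence-free
fields `v₁, …, v_m` satisfying the Lieb–Thirring bound,
`Σ_j (−‖∇v_j‖² − ‖v_j‖² − ∫ ⟨(v_j·∇)u, v_j⟩) ≤ −m + (1/(16√3)) ‖∇u‖²`. -/
theorem trace_estimate_damped_navier_stokes
    (m : ℕ) (u : EuclideanSpace ℝ (Fin 2) → EuclideanSpace ℝ (Fin 2))
    (hu : ContDiff ℝ (⊤ : ℕ∞) u)
    (hufin : Integrable (fun x => ∑ i, ∑ j, (fderiv ℝ u x (euclBasis i) j) ^ 2))
    (hudiv : ∀ x, ∑ i, fderiv ℝ u x (euclBasis i) i = 0)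
    (v : Fin m → (EuclideanSpace ℝ (Fin 2) → EuclideanSpace ℝ (Fin 2)))
    (hv : ∀ j, ContDiff ℝ (⊤ : ℕ∞) (v j))
    (hvs : ∀ j, HasCompactSupport (v j))
    (hvdiv : ∀ j x, ∑ i, fderiv ℝ (v j) x (euclBasis i) i = 0)
    (horth : ∀ j k, (∫ x, ⟪v j x, v k x⟫) = if j = k then (1 : ℝ) else 0)
    (hLT : (∫ x, (∑ j, ‖v j x‖ ^ 2) ^ 2) ≤
      (1 / (2 * Real.sqrt 3)) *
        ∑ j, ∫ x, ∑ i, ∑ k, (fderiv ℝ (v j) x (euclBasis i) k) ^ 2) :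
    (∑ j, (-(∫ x, ∑ i, ∑ k, (fderiv ℝ (v j) x (euclBasis i) k) ^ 2)
        - (∫ x, ‖v j x‖ ^ 2)
        - ∫ x, ⟪∑ i, v j x i • fderiv ℝ u x (euclBasis i), v j x⟫)) ≤
      -(m : ℝ) + (1 / (16 * Real.sqrt 3)) *
        ∫ x, ∑ i, ∑ j, (fderiv ℝ u x (euclBasis i) j) ^ 2 := by
  have hI : ∀ j, Integrable
      (fun x => ⟪∑ i, v j x i • fderiv ℝ u x (euclBasis i), v j x⟫) := by
    intro j
    apply Continuous.integrable_of_hasCompactSupport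
    · have h1 := (hv j).continuous
      have h2 : Continuous (fderiv ℝ u) := hu.continuous_fderiv (by simp)
      fun_prop
    · refine (hvs j).mono ?_
      intro x hx hx0
      apply hx
      simp only [hx0, inner_zero_right]
  have hR : Integrable (fun x => (∑ j, ‖v j x‖ ^ 2) ^ 2) := by
    have hc : ∀ j, Continuous (v j) := fun j => (hv j).continuous
    apply Continuous.integrable_of_hasCompactSupport
    · fun_prop
    · refine HasCompactSupport.intro (isCompact_iUnion fun j => (hvs j)) ?_
      intro x hx
      have : ∀ j, v j x = 0 := fun j => image_eq_zero_of_notMem_tsupport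
        (fun h => hx (Set.mem_iUnion.2 ⟨j, h⟩))
      simp [this]
  have hn : ∀ j, (∫ x, ‖v j x‖ ^ 2) = 1 := by
    intro j
    have := horth j j
    simpa [real_inner_self_eq_norm_sq] using this
  have hpt : ∀ x, -(∑ j, ⟪∑ i, v j x i • fderiv ℝ u x (euclBasis i), v j x⟫) ≤
      2 * Real.sqrt 3 * (∑ j, ‖v j x‖ ^ 2) ^ 2 +
        1 / (16 * Real.sqrt 3) * ∑ i, ∑ j, (fderiv ℝ u x (euclBasis i) j) ^ 2 := by
    intro x
    refine le_trans ?_ (young_bound _ _ (by positivity))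
    rw [← Finset.sum_neg_distrib, Finset.mul_sum]
    refine Finset.sum_le_sum fun j _ => ?_
    have hd := hudiv x
    rw [Fin.sum_univ_two] at hd
    refine le_trans (le_of_eq ?_) (le_trans (pointwise_bound _ (fderiv ℝ u x (euclBasis 0) 1)
      (fderiv ℝ u x (euclBasis 1) 0) _ (v j x 0) (v j x 1) hd) (le_of_eq ?_))
    · simp [PiLp.inner_apply, Fin.sum_univ_two]
      ring
    · simp [EuclideanSpace.norm_sq_eq, Fin.sum_univ_two]
  have hint : -(∑ j, ∫ x, ⟪∑ i, v j x i • fderiv ℝ u x (euclBasis i), v j x⟫) ≤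
      2 * Real.sqrt 3 * (∫ x, (∑ j, ‖v j x‖ ^ 2) ^ 2) +
        1 / (16 * Real.sqrt 3) * ∫ x, ∑ i, ∑ j, (fderiv ℝ u x (euclBasis i) j) ^ 2 := by
    rw [← integral_finsetSum _ (fun j _ => hI j), ← integral_neg, ← integral_const_mul,
      ← integral_const_mul, ← integral_add (hR.const_mul _) (hufin.const_mul _)]
    exact integral_mono (integrable_finsetSum _ fun j _ => hI j).neg
      ((hR.const_mul _).add (hufin.const_mul _)) hpt
  have h3 : 0 < Real.sqrt 3 := by positivity
  have hLT' := mul_le_mul_of_nonneg_left hLT (by positivity : 0 ≤ 2 * Real.sqrt 3)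
  rw [← mul_assoc, mul_one_div_cancel (by positivity), one_mul] at hLT'
  simp only [hn, Finset.sum_sub_distrib, Finset.sum_neg_distrib, Finset.sum_const,
    Finset.card_univ, Fintype.card_fin, nsmul_eq_mul, mul_one]
  linarith
end
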